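/- arXiv:math/0605086 — 3 statements merged into one kernel-verified Lean document; each statement's English description precedes it below -/
import Mathlib

section
/- Let D be an associative unital algebra over a field k with multiplication μ : D ⊗ D → D, and let T be a twistor for D. Define Γ := T₁₃ ∘ T₁₂ and Π := T₁₃ ∘ T₂₃ as linear maps D ⊗ D ⊗ D → D ⊗ D ⊗ D. Then Γ maps ker(id_D ⊗ μ) into ker(id_D ⊗ μ), and Π maps ker(μ ⊗ id_D) into ker(μ ⊗ id_D). Consequently (since over a field ker(id_D ⊗ μ) = D ⊗ ker μ and ker(μ ⊗ id_D) = ker μ ⊗ D), the universal first order differential calculus Ω¹_u(D) = ker μ becomes a D^T-bimodule with left action d → x = (μ ⊗ id_D)(Γ(d ⊗ x)) and right action x ← d = (id_D ⊗ μ)(Π(x ⊗ d)), for d ∈ D and x ∈ ker μ: these actions are unital, associative over D^T, and commute with each other. -/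
open TensorProduct

noncomputable section

/-- `T₁₂ = T ⊗ id` on `(D ⊗ D) ⊗ D`. -/
def tensor12 (k : Type*) [Field k] (D : Type*) [AddCommGroup D] [Module k D]
    (T : D ⊗[k] D →ₗ[k] D ⊗[k] D) :
    (D ⊗[k] D) ⊗[k] D →ₗ[k] (D ⊗[k] D) ⊗[k] D :=
  T.rTensor D

/-- `T₂₃ = id ⊗ T` on `(D ⊗ D) ⊗ D`. -/
def tensor23 (k : Type*) [Field k] (D : Type*) [AddCommGroup D] [Module k D]
    (T : D ⊗[k] D →ₗ[k] D ⊗[k] D) :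
    (D ⊗[k] D) ⊗[k] D →ₗ[k] (D ⊗[k] D) ⊗[k] D :=
  (TensorProduct.assoc k D D D).symm.toLinearMap ∘ₗ T.lTensor D ∘ₗ
    (TensorProduct.assoc k D D D).toLinearMap

/-- the flip `id ⊗ τ` of the last two tensor factors of `(D ⊗ D) ⊗ D`. -/
def flip23 (k : Type*) [Field k] (D : Type*) [AddCommGroup D] [Module k D] :
    (D ⊗[k] D) ⊗[k] D →ₗ[k] (D ⊗[k] D) ⊗[k] D :=
  (TensorProduct.assoc k D D D).symm.toLinearMap ∘ₗ
    ((TensorProduct.comm k D D).toLinearMap.lTensor D) ∘ₗ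
    (TensorProduct.assoc k D D D).toLinearMap

/-- `T₁₃ = (id ⊗ τ) ∘ (T ⊗ id) ∘ (id ⊗ τ)` on `(D ⊗ D) ⊗ D`. -/
def tensor13 (k : Type*) [Field k] (D : Type*) [AddCommGroup D] [Module k D]
    (T : D ⊗[k] D →ₗ[k] D ⊗[k] D) :
    (D ⊗[k] D) ⊗[k] D →ₗ[k] (D ⊗[k] D) ⊗[k] D :=
  flip23 k D ∘ₗ tensor12 k D T ∘ₗ flip23 k D

/-- `μ₁₂ = μ ⊗ id` on `(D ⊗ D) ⊗ D`, for a multiplication `m`. -/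
def mul12 (k : Type*) [Field k] (D : Type*) [AddCommGroup D] [Module k D]
    (m : D ⊗[k] D →ₗ[k] D) :
    (D ⊗[k] D) ⊗[k] D →ₗ[k] D ⊗[k] D :=
  m.rTensor D

/-- `μ₂₃ = id ⊗ μ` on `(D ⊗ D) ⊗ D`, for a multiplication `m`. -/
def mul23 (k : Type*) [Field k] (D : Type*) [AddCommGroup D] [Module k D]
    (m : D ⊗[k] D →ₗ[k] D) :
    (D ⊗[k] D) ⊗[k] D →ₗ[k] D ⊗[k] D :=
  m.lTensor D ∘ₗ (TensorProduct.assoc k D D D).toLinearMap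

/-- A twistor for a (possibly deformed) multiplication `m` with unit `e`:
`T(e ⊗ d) = e ⊗ d`, `T(d ⊗ e) = d ⊗ e`,
`μ₂₃ ∘ T₁₃ ∘ T₁₂ = T ∘ μ₂₃`, `μ₁₂ ∘ T₁₃ ∘ T₂₃ = T ∘ μ₁₂`, `T₁₂ ∘ T₂₃ = T₂₃ ∘ T₁₂`. -/
structure IsTwistor (k : Type*) [Field k] (D : Type*) [AddCommGroup D] [Module k D]
    (m : D ⊗[k] D →ₗ[k] D) (e : D) (T : D ⊗[k] D →ₗ[k] D ⊗[k] D) : Prop where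
  one_left : ∀ d : D, T (e ⊗ₜ[k] d) = e ⊗ₜ[k] d
  one_right : ∀ d : D, T (d ⊗ₜ[k] e) = d ⊗ₜ[k] e
  mul_right : mul23 k D m ∘ₗ tensor13 k D T ∘ₗ tensor12 k D T = T ∘ₗ mul23 k D m
  mul_left : mul12 k D m ∘ₗ tensor13 k D T ∘ₗ tensor23 k D T = T ∘ₗ mul12 k D m
  comm1223 : tensor12 k D T ∘ₗ tensor23 k D T = tensor23 k D T ∘ₗ tensor12 k D T

/-- the deformed left action of `D` on `D ⊗ D`: `d → x = (μ ⊗ id)(T₁₃(T₁₂(d ⊗ x)))`. -/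
def lact (k : Type*) [Field k] (D : Type*) [Ring D] [Algebra k D]
    (T : D ⊗[k] D →ₗ[k] D ⊗[k] D) (d : D) (x : D ⊗[k] D) : D ⊗[k] D :=
  mul12 k D (LinearMap.mul' k D)
    (tensor13 k D T (tensor12 k D T ((TensorProduct.assoc k D D D).symm (d ⊗ₜ[k] x))))

/-- the deformed right action of `D` on `D ⊗ D`: `x ← d = (id ⊗ μ)(T₁₃(T₂₃(x ⊗ d)))`. -/
def ract (k : Type*) [Field k] (D : Type*) [Ring D] [Algebra k D]
    (T : D ⊗[k] D →ₗ[k] D ⊗[k] D) (x : D ⊗[k] D) (d : D) : D ⊗[k] D :=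
  mul23 k D (LinearMap.mul' k D) (tensor13 k D T (tensor23 k D T (x ⊗ₜ[k] d)))

section helpers

variable {k : Type*} [Field k] {D : Type*}

section lin
variable [AddCommGroup D] [Module k D]

/-- flip of the last two factors among four -/
def F34 : ((D ⊗[k] D) ⊗[k] D) ⊗[k] D →ₗ[k] ((D ⊗[k] D) ⊗[k] D) ⊗[k] D :=
  (TensorProduct.assoc k (D ⊗[k] D) D D).symm.toLinearMap ∘ₗ
    ((TensorProduct.comm k D D).toLinearMap.lTensor (D ⊗[k] D)) ∘ₗ
    (TensorProduct.assoc k (D ⊗[k] D) D D).toLinearMap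

/-- flip of the middle two factors among four -/
def F23 : ((D ⊗[k] D) ⊗[k] D) ⊗[k] D →ₗ[k] ((D ⊗[k] D) ⊗[k] D) ⊗[k] D :=
  (flip23 k D).rTensor D

/-- insertion of a first factor -/
def shift (d : D) : (D ⊗[k] D) ⊗[k] D →ₗ[k] ((D ⊗[k] D) ⊗[k] D) ⊗[k] D :=
  ((TensorProduct.assoc k D D D).symm.toLinearMap ∘ₗ TensorProduct.mk k D (D ⊗[k] D) d).rTensor D

/-- multiplication of the last two factors among four -/
def M34 (m : D ⊗[k] D →ₗ[k] D) : ((D ⊗[k] D) ⊗[k] D) ⊗[k] D →ₗ[k] (D ⊗[k] D) ⊗[k] D :=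
  m.lTensor (D ⊗[k] D) ∘ₗ (TensorProduct.assoc k (D ⊗[k] D) D D).toLinearMap

def M12 (m : D ⊗[k] D →ₗ[k] D) : ((D ⊗[k] D) ⊗[k] D) ⊗[k] D →ₗ[k] (D ⊗[k] D) ⊗[k] D :=
  (mul12 k D m).rTensor D

def M23 (m : D ⊗[k] D →ₗ[k] D) : ((D ⊗[k] D) ⊗[k] D) ⊗[k] D →ₗ[k] (D ⊗[k] D) ⊗[k] D :=
  (mul23 k D m).rTensor D

variable (T : D ⊗[k] D →ₗ[k] D ⊗[k] D)

def Q12 : ((D ⊗[k] D) ⊗[k] D) ⊗[k] D →ₗ[k] ((D ⊗[k] D) ⊗[k] D) ⊗[k] D :=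
  (tensor12 k D T).rTensor D
def Q23 : ((D ⊗[k] D) ⊗[k] D) ⊗[k] D →ₗ[k] ((D ⊗[k] D) ⊗[k] D) ⊗[k] D :=
  (tensor23 k D T).rTensor D
def Q13 : ((D ⊗[k] D) ⊗[k] D) ⊗[k] D →ₗ[k] ((D ⊗[k] D) ⊗[k] D) ⊗[k] D :=
  (tensor13 k D T).rTensor D
def Q24 : ((D ⊗[k] D) ⊗[k] D) ⊗[k] D →ₗ[k] ((D ⊗[k] D) ⊗[k] D) ⊗[k] D :=
  F34 ∘ₗ Q23 T ∘ₗ F34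
def Q14 : ((D ⊗[k] D) ⊗[k] D) ⊗[k] D →ₗ[k] ((D ⊗[k] D) ⊗[k] D) ⊗[k] D :=
  F34 ∘ₗ Q13 T ∘ₗ F34
def Q34 : ((D ⊗[k] D) ⊗[k] D) ⊗[k] D →ₗ[k] ((D ⊗[k] D) ⊗[k] D) ⊗[k] D :=
  F23 ∘ₗ Q24 T ∘ₗ F23

@[simp] lemma flip23_tmul (a b c : D) :
    flip23 k D ((a ⊗ₜ[k] b) ⊗ₜ[k] c) = (a ⊗ₜ[k] c) ⊗ₜ[k] b := by simp [flip23]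
@[simp] lemma F34_tmul (a : D ⊗[k] D) (b c : D) :
    F34 ((a ⊗ₜ[k] b) ⊗ₜ[k] c) = (a ⊗ₜ[k] c) ⊗ₜ[k] b := by simp [F34]
@[simp] lemma F23_tmul (a b c e : D) :
    F23 (((a ⊗ₜ[k] b) ⊗ₜ[k] c) ⊗ₜ[k] e) = ((a ⊗ₜ[k] c) ⊗ₜ[k] b) ⊗ₜ[k] e := by simp [F23]
@[simp] lemma shift_tmul (d a b c : D) :
    shift d ((a ⊗ₜ[k] b) ⊗ₜ[k] c) = ((d ⊗ₜ[k] a) ⊗ₜ[k] b) ⊗ₜ[k] c := by simp [shift]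
variable (m : D ⊗[k] D →ₗ[k] D)
@[simp] lemma mul12_tmul (x : D ⊗[k] D) (c : D) :
    mul12 k D m (x ⊗ₜ[k] c) = m x ⊗ₜ[k] c := by simp [mul12]
@[simp] lemma mul23_tmul (a b c : D) :
    mul23 k D m ((a ⊗ₜ[k] b) ⊗ₜ[k] c) = a ⊗ₜ[k] m (b ⊗ₜ[k] c) := by simp [mul23]
@[simp] lemma M12_tmul (x : D ⊗[k] D) (c e : D) :
    M12 m ((x ⊗ₜ[k] c) ⊗ₜ[k] e) = (m x ⊗ₜ[k] c) ⊗ₜ[k] e := by simp [M12]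
@[simp] lemma M23_tmul (a b c e : D) :
    M23 m (((a ⊗ₜ[k] b) ⊗ₜ[k] c) ⊗ₜ[k] e) = (a ⊗ₜ[k] m (b ⊗ₜ[k] c)) ⊗ₜ[k] e := by simp [M23]
@[simp] lemma M34_tmul (x : D ⊗[k] D) (c e : D) :
    M34 m ((x ⊗ₜ[k] c) ⊗ₜ[k] e) = x ⊗ₜ[k] m (c ⊗ₜ[k] e) := by simp [M34]

lemma ind2 {p : D ⊗[k] D → Prop} (h : ∀ a b, p (a ⊗ₜ b)) (ha : ∀ x y, p x → p y → p (x + y))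
    (x) : p x := by
  induction x with
  | zero => simpa using h 0 0
  | tmul a b => exact h a b
  | add x y hx hy => exact ha x y hx hy

lemma eq3 {N : Type*} [AddCommMonoid N] [Module k N] (f g : (D ⊗[k] D) ⊗[k] D →ₗ[k] N)
    (h : ∀ a b c, f ((a ⊗ₜ b) ⊗ₜ c) = g ((a ⊗ₜ b) ⊗ₜ c)) (v) : f v = g v := by
  have : f = g := TensorProduct.ext_threefold h
  rw [this]

lemma eq4 {N : Type*} [AddCommMonoid N] [Module k N] (f g : ((D ⊗[k] D) ⊗[k] D) ⊗[k] D →ₗ[k] N)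
    (h : ∀ a b c e, f (((a ⊗ₜ b) ⊗ₜ c) ⊗ₜ e) = g (((a ⊗ₜ b) ⊗ₜ c) ⊗ₜ e)) (v) : f v = g v := by
  have : f = g := by
    apply TensorProduct.ext
    apply TensorProduct.ext_threefold
    intro a b c
    ext e
    exact h a b c e
  rw [this]

lemma eq2 {N : Type*} [AddCommMonoid N] [Module k N] (f g : D ⊗[k] D →ₗ[k] N)
    (h : ∀ a b, f (a ⊗ₜ b) = g (a ⊗ₜ b)) (v) : f v = g v := by
  have : f = g := TensorProduct.ext' h
  rw [this]

@[simp] lemma flip23_flip23 (v) : flip23 k D (flip23 k D v) = v :=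
  eq3 (flip23 k D ∘ₗ flip23 k D) LinearMap.id (by intros; simp) v
@[simp] lemma F34_F34 (v) : F34 (k := k) (D := D) (F34 v) = v :=
  eq4 (F34 ∘ₗ F34) LinearMap.id (by intros; simp) v
@[simp] lemma F23_F23 (v) : F23 (k := k) (D := D) (F23 v) = v :=
  eq4 (F23 ∘ₗ F23) LinearMap.id (by intros; simp) v
lemma braid (v) : F34 (k := k) (D := D) (F23 (F34 v)) = F23 (F34 (F23 v)) :=
  eq4 (F34 ∘ₗ F23 ∘ₗ F34) (F23 ∘ₗ F34 ∘ₗ F23) (by intros; simp) v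

@[simp] lemma tensor12_tmul (x : D ⊗[k] D) (c : D) :
    tensor12 k D T (x ⊗ₜ[k] c) = T x ⊗ₜ[k] c := by simp [tensor12]
@[simp] lemma Q12_tmul (x : D ⊗[k] D) (c e : D) :
    Q12 T ((x ⊗ₜ[k] c) ⊗ₜ[k] e) = (T x ⊗ₜ[k] c) ⊗ₜ[k] e := by simp [Q12]
lemma tensor23_tmul (a b c : D) :
    tensor23 k D T ((a ⊗ₜ[k] b) ⊗ₜ[k] c) =
      (TensorProduct.assoc k D D D).symm (a ⊗ₜ[k] T (b ⊗ₜ[k] c)) := by simp [tensor23]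
lemma tensor23_assoc (a : D) (x : D ⊗[k] D) :
    tensor23 k D T ((TensorProduct.assoc k D D D).symm (a ⊗ₜ[k] x)) =
      (TensorProduct.assoc k D D D).symm (a ⊗ₜ[k] T x) := by simp [tensor23]
lemma tensor13_apply (v) :
    tensor13 k D T v = flip23 k D (tensor12 k D T (flip23 k D v)) := rfl
lemma Q24_apply (v) : Q24 T v = F34 (Q23 T (F34 v)) := rfl
lemma Q14_apply (v) : Q14 T v = F34 (Q13 T (F34 v)) := rfl
lemma Q34_apply (v) : Q34 T v = F23 (Q24 T (F23 v)) := rfl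
lemma Q13_apply (v) : Q13 T v = F23 (Q12 T (F23 v)) := by
  simp only [Q13, Q12, F23, tensor13, LinearMap.rTensor_comp, LinearMap.comp_apply]

/-- `T₁₂` commutes with the flip of the last two factors. -/
lemma Q12_F34 (v) : Q12 T (F34 v) = F34 (Q12 T v) :=
  eq4 (Q12 T ∘ₗ F34) (F34 ∘ₗ Q12 T) (by intros; simp) v

lemma Q14_F23 (v) : F23 (Q14 T (F23 v)) = Q14 T v := by
  simp only [Q14_apply, Q13_apply]
  rw [← braid, ← braid, Q12_F34, F34_F34]

/-- disjoint -/
lemma shift_tensor12 (d : D) (v) : shift d (tensor12 k D T v) = Q23 T (shift d v) := by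
  refine eq3 (shift d ∘ₗ tensor12 k D T) (Q23 T ∘ₗ shift d) ?_ v
  intro a b c
  simp [Q23, tensor23_tmul, shift]

lemma shift_flip23 (d : D) (v) : shift d (flip23 k D v) = F34 (shift d v) :=
  eq3 (shift d ∘ₗ flip23 k D) (F34 ∘ₗ shift d) (by intros; simp) v

lemma shift_tensor13 (d : D) (v) : shift d (tensor13 k D T v) = Q24 T (shift d v) := by
  rw [tensor13_apply, shift_flip23, shift_tensor12, shift_flip23, Q24_apply]

lemma Q34_tmul (x : D ⊗[k] D) (c e : D) : Q34 T ((x ⊗ₜ c) ⊗ₜ e) =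
    (TensorProduct.assoc k (D ⊗[k] D) D D).symm (x ⊗ₜ T (c ⊗ₜ e)) := by
  induction x using ind2 with
  | ha x y hx hy => simp only [TensorProduct.add_tmul, map_add, hx, hy]
  | h a b =>
    simp only [Q34_apply, Q24_apply, Q23, F23_tmul, F34_tmul, LinearMap.rTensor_tmul,
      tensor23_tmul]
    generalize T (c ⊗ₜ e) = t
    induction t using ind2 with
    | ha x y hx hy => simp only [TensorProduct.tmul_add, TensorProduct.add_tmul, map_add, hx, hy]
    | h a b => simp

lemma shift_tensor23 (d : D) (v) : shift d (tensor23 k D T v) = Q34 T (shift d v) := by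
  refine eq3 (shift d ∘ₗ tensor23 k D T) (Q34 T ∘ₗ shift d) ?_ v
  intro a b c
  simp only [LinearMap.comp_apply, shift_tmul, Q34_tmul, tensor23_tmul]
  generalize T (b ⊗ₜ c) = t
  induction t using ind2 with
  | ha x y hx hy => simp only [TensorProduct.tmul_add, map_add, hx, hy]
  | h a b => simp

lemma shift_mul12 (d : D) (v) :
    (TensorProduct.assoc k D D D).symm (d ⊗ₜ mul12 k D m v) = M23 m (shift d v) :=
  eq3 ((TensorProduct.assoc k D D D).symm.toLinearMap ∘ₗ TensorProduct.mk k D (D ⊗[k] D) d ∘ₗ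
    mul12 k D m) (M23 m ∘ₗ shift d) (by intros; simp) v

lemma shift_mul23 (d : D) (v) :
    (TensorProduct.assoc k D D D).symm (d ⊗ₜ mul23 k D m v) = M34 m (shift d v) :=
  eq3 ((TensorProduct.assoc k D D D).symm.toLinearMap ∘ₗ TensorProduct.mk k D (D ⊗[k] D) d ∘ₗ
    mul23 k D m) (M34 m ∘ₗ shift d) (by intros; simp) v

lemma eq4s {N : Type*} [AddCommMonoid N] [Module k N] (f g : ((D ⊗[k] D) ⊗[k] D) ⊗[k] D →ₗ[k] N)
    (h : ∀ d v, f (shift d v) = g (shift d v)) (v) : f v = g v :=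
  eq4 f g (fun a b c e => by rw [← shift_tmul, h]) v

/-- disjoint operators commute -/
lemma Q12_Q34 (v) : Q12 T (Q34 T v) = Q34 T (Q12 T v) := by
  refine eq4 (Q12 T ∘ₗ Q34 T) (Q34 T ∘ₗ Q12 T) ?_ v
  intro a b c e
  simp only [LinearMap.comp_apply, Q34_tmul, Q12_tmul]
  generalize T (c ⊗ₜ e) = t
  induction t using ind2 with
  | ha x y hx hy => simp only [TensorProduct.tmul_add, map_add, hx, hy]
  | h a b => simp

lemma Q13_Q24 (v) : Q13 T (Q24 T v) = Q24 T (Q13 T v) := by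
  have h : ∀ v, Q24 T v = F23 (Q34 T (F23 v)) := by intro v; simp [Q34_apply]
  simp [h, Q13_apply, Q12_Q34]

lemma flip_M12 (v) : flip23 k D (M12 m v) = M12 m (F34 v) :=
  eq4 (flip23 k D ∘ₗ M12 m) (M12 m ∘ₗ F34) (by intros; simp) v
lemma flip_M34 (v) : flip23 k D (M34 m v) = M23 m (F34 (F23 v)) :=
  eq4 (flip23 k D ∘ₗ M34 m) (M23 m ∘ₗ F34 ∘ₗ F23) (by intros; simp) v
lemma flip_M23 (v) : flip23 k D (M23 m v) = M34 m (F23 (F34 v)) :=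
  eq4 (flip23 k D ∘ₗ M23 m) (M34 m ∘ₗ F23 ∘ₗ F34) (by intros; simp) v
lemma t12_M34 (v) : tensor12 k D T (M34 m v) = M34 m (Q12 T v) :=
  eq4 (tensor12 k D T ∘ₗ M34 m) (M34 m ∘ₗ Q12 T) (by intros; simp) v
lemma t13_M23 (v) : tensor13 k D T (M23 m v) = M23 m (Q14 T v) := by
  rw [tensor13_apply, flip_M23, t12_M34, flip_M34, Q14_apply, Q13_apply]
lemma t23_M12 (v) : tensor23 k D T (M12 m v) = M12 m (Q34 T v) := by
  refine eq4 (tensor23 k D T ∘ₗ M12 m) (M12 m ∘ₗ Q34 T) ?_ v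
  intro a b c e
  simp only [LinearMap.comp_apply, Q34_tmul, M12_tmul, tensor23_tmul]
  generalize T (c ⊗ₜ e) = t
  induction t using ind2 with
  | ha x y hx hy => simp only [TensorProduct.tmul_add, map_add, hx, hy]
  | h a b => simp

variable {T m} {e : D}

lemma c1 (hT : IsTwistor k D m e T) (v) : tensor12 k D T (M12 m v) = M12 m (Q13 T (Q23 T v)) := by
  have := congrArg (fun f => LinearMap.rTensor D f v) hT.mul_left
  simp only [LinearMap.rTensor_comp, LinearMap.comp_apply] at this
  exact this.symm
lemma c2 (hT : IsTwistor k D m e T) (v) : tensor12 k D T (M23 m v) = M23 m (Q13 T (Q12 T v)) := by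
  have := congrArg (fun f => LinearMap.rTensor D f v) hT.mul_right
  simp only [LinearMap.rTensor_comp, LinearMap.comp_apply] at this
  exact this.symm
lemma c3 (hT : IsTwistor k D m e T) (v) : tensor13 k D T (M12 m v) = M12 m (Q14 T (Q24 T v)) := by
  rw [tensor13_apply, flip_M12, c1 hT, flip_M12, Q14_apply, Q24_apply, F34_F34]
lemma c4 (hT : IsTwistor k D m e T) (v) : tensor13 k D T (M34 m v) = M34 m (Q14 T (Q13 T v)) := by
  rw [tensor13_apply, flip_M34, c2 hT, flip_M23, Q12_F34, ← Q14_apply, ← Q14_F23, F23_F23,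
    ← Q13_apply]
lemma c5 (hT : IsTwistor k D m e T) (v) : tensor23 k D T (M23 m v) = M23 m (Q24 T (Q34 T v)) := by
  refine eq4s (tensor23 k D T ∘ₗ M23 m) (M23 m ∘ₗ Q24 T ∘ₗ Q34 T) ?_ v
  intro d v
  have := LinearMap.congr_fun hT.mul_left v
  simp only [LinearMap.comp_apply] at this ⊢
  rw [← shift_tensor23, ← shift_tensor13, ← shift_mul12, ← shift_mul12, this, tensor23_assoc]
lemma c6 (hT : IsTwistor k D m e T) (v) : tensor23 k D T (M34 m v) = M34 m (Q24 T (Q23 T v)) := by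
  refine eq4s (tensor23 k D T ∘ₗ M34 m) (M34 m ∘ₗ Q24 T ∘ₗ Q23 T) ?_ v
  intro d v
  have := LinearMap.congr_fun hT.mul_right v
  simp only [LinearMap.comp_apply] at this ⊢
  rw [← shift_tensor12, ← shift_tensor13, ← shift_mul23, ← shift_mul23, this, tensor23_assoc]

lemma q1223 (hT : IsTwistor k D m e T) (v) : Q12 T (Q23 T v) = Q23 T (Q12 T v) := by
  have := congrArg (fun f => LinearMap.rTensor D f v) hT.comm1223
  simp only [LinearMap.rTensor_comp, LinearMap.comp_apply] at this
  exact this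
lemma q1224 (hT : IsTwistor k D m e T) (v) : Q12 T (Q24 T v) = Q24 T (Q12 T v) := by
  rw [Q24_apply, Q24_apply, Q12_F34, q1223 hT, Q12_F34]
lemma q1334 (hT : IsTwistor k D m e T) (v) : Q13 T (Q34 T v) = Q34 T (Q13 T v) := by
  simp only [Q13_apply, Q34_apply, F23_F23, q1224 hT]
lemma q2334 (hT : IsTwistor k D m e T) (v) : Q23 T (Q34 T v) = Q34 T (Q23 T v) := by
  refine eq4s (Q23 T ∘ₗ Q34 T) (Q34 T ∘ₗ Q23 T) ?_ v
  intro d v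
  have := LinearMap.congr_fun hT.comm1223 v
  simp only [LinearMap.comp_apply] at this ⊢
  rw [← shift_tensor23, ← shift_tensor12, ← shift_tensor12, ← shift_tensor23, this]

end lin

variable [Ring D] [Algebra k D]

lemma a1 (v) : mul12 k D (LinearMap.mul' k D) (M12 (LinearMap.mul' k D) v) =
    mul12 k D (LinearMap.mul' k D) (M23 (LinearMap.mul' k D) v) :=
  eq4 (mul12 k D (LinearMap.mul' k D) ∘ₗ M12 (LinearMap.mul' k D))
    (mul12 k D (LinearMap.mul' k D) ∘ₗ M23 (LinearMap.mul' k D)) (by intros; simp [mul_assoc]) v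
lemma a2 (v) : mul23 k D (LinearMap.mul' k D) (M23 (LinearMap.mul' k D) v) =
    mul23 k D (LinearMap.mul' k D) (M34 (LinearMap.mul' k D) v) :=
  eq4 (mul23 k D (LinearMap.mul' k D) ∘ₗ M23 (LinearMap.mul' k D))
    (mul23 k D (LinearMap.mul' k D) ∘ₗ M34 (LinearMap.mul' k D)) (by intros; simp [mul_assoc]) v
lemma a3 (v) : mul12 k D (LinearMap.mul' k D) (M34 (LinearMap.mul' k D) v) =
    mul23 k D (LinearMap.mul' k D) (M12 (LinearMap.mul' k D) v) :=
  eq4 (mul12 k D (LinearMap.mul' k D) ∘ₗ M34 (LinearMap.mul' k D))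
    (mul23 k D (LinearMap.mul' k D) ∘ₗ M12 (LinearMap.mul' k D)) (by intros; simp) v
lemma a4 (v) : LinearMap.mul' k D (mul12 k D (LinearMap.mul' k D) v) =
    LinearMap.mul' k D (mul23 k D (LinearMap.mul' k D) v) :=
  eq3 (LinearMap.mul' k D ∘ₗ mul12 k D (LinearMap.mul' k D))
    (LinearMap.mul' k D ∘ₗ mul23 k D (LinearMap.mul' k D)) (by intros; simp [mul_assoc]) v

end helpers

/-- Proposition 5.7: for a twistor `T` on `D`, the maps `Γ = T₁₃ ∘ T₁₂` and `Π = T₁₃ ∘ T₂₃`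
preserve the kernels of `id ⊗ μ` and `μ ⊗ id` respectively, and hence the universal first
order differential calculus `Ω¹_u(D) = ker μ` becomes a `D^T`-bimodule via
`d → x = (μ ⊗ id)(Γ(d ⊗ x))` and `x ← d = (id ⊗ μ)(Π(x ⊗ d))`. -/
theorem kernel_mu_bimodule (k : Type*) [Field k] (D : Type*) [Ring D] [Algebra k D]
    (T : D ⊗[k] D →ₗ[k] D ⊗[k] D) (hT : IsTwistor k D (LinearMap.mul' k D) 1 T) :
    (∀ x : (D ⊗[k] D) ⊗[k] D, mul23 k D (LinearMap.mul' k D) x = 0 →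
      mul23 k D (LinearMap.mul' k D) (tensor13 k D T (tensor12 k D T x)) = 0) ∧
    (∀ x : (D ⊗[k] D) ⊗[k] D, mul12 k D (LinearMap.mul' k D) x = 0 →
      mul12 k D (LinearMap.mul' k D) (tensor13 k D T (tensor23 k D T x)) = 0) ∧
    (∀ (d : D) (x : D ⊗[k] D), LinearMap.mul' k D x = 0 →
      LinearMap.mul' k D (lact k D T d x) = 0) ∧
    (∀ (d : D) (x : D ⊗[k] D), LinearMap.mul' k D x = 0 →
      LinearMap.mul' k D (ract k D T x d) = 0) ∧
    (∀ x : D ⊗[k] D, LinearMap.mul' k D x = 0 → lact k D T 1 x = x) ∧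
    (∀ x : D ⊗[k] D, LinearMap.mul' k D x = 0 → ract k D T x 1 = x) ∧
    (∀ (d d' : D) (x : D ⊗[k] D), LinearMap.mul' k D x = 0 →
      lact k D T (LinearMap.mul' k D (T (d ⊗ₜ[k] d'))) x = lact k D T d (lact k D T d' x)) ∧
    (∀ (d d' : D) (x : D ⊗[k] D), LinearMap.mul' k D x = 0 →
      ract k D T x (LinearMap.mul' k D (T (d ⊗ₜ[k] d'))) = ract k D T (ract k D T x d) d') ∧
    (∀ (d d' : D) (x : D ⊗[k] D), LinearMap.mul' k D x = 0 →
      lact k D T d (ract k D T x d') = ract k D T (lact k D T d x) d') := by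
  have hR := fun v => LinearMap.congr_fun hT.mul_right v
  have hL := fun v => LinearMap.congr_fun hT.mul_left v
  simp only [LinearMap.comp_apply] at hR hL
  refine ⟨?_, ?_, ?_, ?_, ?_, ?_, ?_, ?_, ?_⟩
  · intro x hx
    rw [hR, hx, map_zero]
  · intro x hx
    rw [hL, hx, map_zero]
  · intro d x hx
    rw [lact, a4, hR]
    simp [mul23, hx]
  · intro d x hx
    rw [ract, ← a4, hL]
    simp [mul12, hx]
  · intro x hx0
    clear hx0
    induction x using ind2 with
    | ha x y hx hy =>
      unfold lact at *
      simp only [TensorProduct.tmul_add, map_add, hx, hy]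
    | h a b => simp [lact, tensor13_apply, hT.one_left]
  · intro x hx0
    clear hx0
    induction x using ind2 with
    | ha x y hx hy =>
      unfold ract at *
      simp only [TensorProduct.add_tmul, map_add, hx, hy]
    | h a b => simp [ract, tensor13_apply, tensor23_tmul, hT.one_right]
  · intro d d' x hx0
    clear hx0
    have h1 : (TensorProduct.assoc k D D D).symm (LinearMap.mul' k D (T (d ⊗ₜ[k] d')) ⊗ₜ[k] x) =
        M12 (LinearMap.mul' k D) (Q12 T
          (shift d ((TensorProduct.assoc k D D D).symm (d' ⊗ₜ x)))) := by
      induction x using ind2 with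
      | ha x y hx hy => simp only [TensorProduct.tmul_add, map_add, hx, hy]
      | h a b => simp
    simp only [lact]
    rw [h1, shift_mul12, shift_tensor13, shift_tensor12]
    rw [c1 hT, c3 hT, a1, c2 hT, t13_M23]
    rw [q1224 hT, q1223 hT, Q13_Q24]
  · intro d d' x hx0
    clear hx0
    have h1 : x ⊗ₜ[k] LinearMap.mul' k D (T (d ⊗ₜ[k] d')) =
        M34 (LinearMap.mul' k D) (Q34 T ((x ⊗ₜ d) ⊗ₜ d')) := by
      rw [Q34_tmul]
      simp [M34]
    have h2 : ∀ v : (D ⊗[k] D) ⊗[k] D, mul23 k D (LinearMap.mul' k D) v ⊗ₜ[k] d' =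
      M23 (LinearMap.mul' k D) (v ⊗ₜ d') := fun v => by simp [M23]
    have h3 : ∀ v : (D ⊗[k] D) ⊗[k] D, tensor13 k D T v ⊗ₜ[k] d' = Q13 T (v ⊗ₜ d') :=
      fun v => by simp [Q13]
    have h4 : ∀ v : (D ⊗[k] D) ⊗[k] D, tensor23 k D T v ⊗ₜ[k] d' = Q23 T (v ⊗ₜ d') :=
      fun v => by simp [Q23]
    simp only [ract]
    rw [h1, h2, h3, h4, c6 hT, c4 hT, c5 hT, t13_M23, a2]
    rw [q2334 hT, ← q1334 hT, ← q2334 hT, Q13_Q24]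
  · intro d d' x hx0
    clear hx0
    have h1 : shift d (x ⊗ₜ[k] d') =
        (TensorProduct.assoc k D D D).symm (d ⊗ₜ[k] x) ⊗ₜ[k] d' := by
      simp [shift]
    have h2 : ∀ v : (D ⊗[k] D) ⊗[k] D, mul12 k D (LinearMap.mul' k D) v ⊗ₜ[k] d' =
      M12 (LinearMap.mul' k D) (v ⊗ₜ d') := fun v => by simp [M12]
    have h3 : ∀ v : (D ⊗[k] D) ⊗[k] D, tensor13 k D T v ⊗ₜ[k] d' = Q13 T (v ⊗ₜ d') :=
      fun v => by simp [Q13]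
    have h4 : ∀ v : (D ⊗[k] D) ⊗[k] D, tensor12 k D T v ⊗ₜ[k] d' = Q12 T (v ⊗ₜ d') :=
      fun v => by simp [Q12]
    simp only [lact, ract]
    rw [shift_mul23, shift_tensor13, shift_tensor23, h1, h2, h3, h4, t12_M34, c4 hT, a3,
      t23_M12, c3 hT]
    rw [q1224 hT, Q12_Q34, Q13_Q24, q1334 hT]
end
end

section
/- Let D be an associative unital algebra over a field k with multiplication μ, let T be a twistor for D, and let δ : D → D ⊗ D be the linear map δ(d) = d ⊗ 1 − 1 ⊗ d (the canonical derivation into ker μ). Then δ is a D^T-derivation from D^T to ker μ with respect to the D^T-bimodule structure on ker μ given by d → x = (μ ⊗ id_D)(T₁₃(T₁₂(d ⊗ x))) and x ← d = (id_D ⊗ μ)(T₁₃(T₂₃(x ⊗ d))); explicitly, for all d, d' ∈ D: δ(μ(T(d ⊗ d'))) = (μ ⊗ id_D)(T₁₃(T₁₂(d ⊗ δ(d')))) + (id_D ⊗ μ)(T₁₃(T₂₃(δ(d) ⊗ d'))). -/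
open TensorProduct

noncomputable section

/-- the canonical derivation `δ(d) = d ⊗ 1 - 1 ⊗ d` of `D` into `ker μ ⊆ D ⊗ D`. -/
def delta (k : Type*) [Field k] (D : Type*) [Ring D] [Algebra k D] (d : D) : D ⊗[k] D :=
  d ⊗ₜ[k] (1 : D) - (1 : D) ⊗ₜ[k] d

/-- `T₁₃` fixes `x ⊗ 1`. -/
theorem tensor13_one_right (k : Type*) [Field k] (D : Type*) [Ring D] [Algebra k D]
    (T : D ⊗[k] D →ₗ[k] D ⊗[k] D) (h : ∀ d : D, T (d ⊗ₜ[k] (1 : D)) = d ⊗ₜ[k] (1 : D))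
    (x : D ⊗[k] D) : tensor13 k D T (x ⊗ₜ[k] (1 : D)) = x ⊗ₜ[k] (1 : D) := by
  induction x using TensorProduct.induction_on with
  | zero => simp
  | tmul a b => simp [tensor13, flip23, tensor12, h]
  | add x y hx hy => rw [TensorProduct.add_tmul, map_add, hx, hy]

/-- `T₁₃` fixes `1 ⊗ x`. -/
theorem tensor13_one_left (k : Type*) [Field k] (D : Type*) [Ring D] [Algebra k D]
    (T : D ⊗[k] D →ₗ[k] D ⊗[k] D) (h : ∀ d : D, T ((1 : D) ⊗ₜ[k] d) = (1 : D) ⊗ₜ[k] d)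
    (x : D ⊗[k] D) :
    tensor13 k D T ((TensorProduct.assoc k D D D).symm ((1 : D) ⊗ₜ[k] x)) =
      (TensorProduct.assoc k D D D).symm ((1 : D) ⊗ₜ[k] x) := by
  induction x using TensorProduct.induction_on with
  | zero => simp
  | tmul a b => simp [tensor13, flip23, tensor12, h]
  | add x y hx hy => rw [TensorProduct.tmul_add, map_add, map_add, hx, hy]

/-- Multiplying away a unit in the middle (first two factors). -/
theorem mul12_flip_one (k : Type*) [Field k] (D : Type*) [Ring D] [Algebra k D]
    (x : D ⊗[k] D) :
    mul12 k D (LinearMap.mul' k D) (flip23 k D (x ⊗ₜ[k] (1 : D))) = x := by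
  induction x using TensorProduct.induction_on with
  | zero => simp
  | tmul a b => simp [mul12, flip23]
  | add x y hx hy => rw [TensorProduct.add_tmul, map_add, map_add, hx, hy]

/-- Multiplying away a unit in the middle (last two factors). -/
theorem mul23_flip_one (k : Type*) [Field k] (D : Type*) [Ring D] [Algebra k D]
    (x : D ⊗[k] D) :
    mul23 k D (LinearMap.mul' k D) (flip23 k D (x ⊗ₜ[k] (1 : D))) = x := by
  induction x using TensorProduct.induction_on with
  | zero => simp
  | tmul a b => simp [mul23, flip23]
  | add x y hx hy => rw [TensorProduct.add_tmul, map_add, map_add, hx, hy]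

/-- Value of the map on a tensor with unit middle factor. -/
theorem tensor13_mid_one (k : Type*) [Field k] (D : Type*) [Ring D] [Algebra k D]
    (T : D ⊗[k] D →ₗ[k] D ⊗[k] D) (d d' : D) :
    tensor13 k D T ((d ⊗ₜ[k] (1 : D)) ⊗ₜ[k] d') =
      flip23 k D (T (d ⊗ₜ[k] d') ⊗ₜ[k] (1 : D)) := by
  simp [tensor13, flip23, tensor12]

/-- Proposition 5.8: the canonical derivation `δ(d) = d ⊗ 1 - 1 ⊗ d` is also a
`D^T`-derivation from `D^T` to `ker μ`, with respect to the deformed bimodule structure: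
`δ(d * d') = d → δ(d') + δ(d) ← d'`. -/
theorem delta_is_twisted_derivation (k : Type*) [Field k] (D : Type*) [Ring D] [Algebra k D]
    (T : D ⊗[k] D →ₗ[k] D ⊗[k] D) (hT : IsTwistor k D (LinearMap.mul' k D) 1 T) :
    ∀ d d' : D,
      delta k D (LinearMap.mul' k D (T (d ⊗ₜ[k] d'))) =
        lact k D T d (delta k D d') + ract k D T (delta k D d) d' := by
  intro d d'
  have h1 : lact k D T d (d' ⊗ₜ[k] (1 : D)) =
      LinearMap.mul' k D (T (d ⊗ₜ[k] d')) ⊗ₜ[k] (1 : D) := by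
    have e : tensor12 k D T ((d ⊗ₜ[k] d') ⊗ₜ[k] (1 : D)) = T (d ⊗ₜ[k] d') ⊗ₜ[k] (1 : D) := by
      simp [tensor12]
    rw [lact, TensorProduct.assoc_symm_tmul, e, tensor13_one_right k D T hT.one_right]
    simp [mul12]
  have h2 : lact k D T d ((1 : D) ⊗ₜ[k] d') = T (d ⊗ₜ[k] d') := by
    have e : tensor12 k D T ((d ⊗ₜ[k] (1 : D)) ⊗ₜ[k] d') = (d ⊗ₜ[k] (1 : D)) ⊗ₜ[k] d' := by
      simp [tensor12, hT.one_right]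
    rw [lact, TensorProduct.assoc_symm_tmul, e, tensor13_mid_one, mul12_flip_one]
  have h3 : ract k D T (d ⊗ₜ[k] (1 : D)) d' = T (d ⊗ₜ[k] d') := by
    have e : tensor23 k D T ((d ⊗ₜ[k] (1 : D)) ⊗ₜ[k] d') = (d ⊗ₜ[k] (1 : D)) ⊗ₜ[k] d' := by
      simp [tensor23, hT.one_left]
    rw [ract, e, tensor13_mid_one, mul23_flip_one]
  have h4 : ract k D T ((1 : D) ⊗ₜ[k] d) d' =
      (1 : D) ⊗ₜ[k] LinearMap.mul' k D (T (d ⊗ₜ[k] d')) := by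
    have e : tensor23 k D T (((1 : D) ⊗ₜ[k] d) ⊗ₜ[k] d') =
        (TensorProduct.assoc k D D D).symm ((1 : D) ⊗ₜ[k] T (d ⊗ₜ[k] d')) := by
      simp [tensor23]
    rw [ract, e, tensor13_one_left k D T hT.one_left]
    simp [mul23]
  have h5 : lact k D T d (delta k D d') =
      lact k D T d (d' ⊗ₜ[k] (1 : D)) - lact k D T d ((1 : D) ⊗ₜ[k] d') := by
    simp only [lact, delta, TensorProduct.tmul_sub, map_sub]
  have h6 : ract k D T (delta k D d) d' =
      ract k D T (d ⊗ₜ[k] (1 : D)) d' - ract k D T ((1 : D) ⊗ₜ[k] d) d' := by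
    simp only [ract, delta, TensorProduct.sub_tmul, map_sub]
  rw [h5, h6, h1, h2, h3, h4, delta]
  abel
end
end

section
/- Let D be an associative unital algebra over a field k with multiplication μ, and let T be a bijective twistor for D. Let δ : D → D ⊗ D, δ(d) = d ⊗ 1 − 1 ⊗ d. Then ker μ equals the linear span of the set { (id_D ⊗ μ)(T₁₃(T₂₃(δ(a) ⊗ b))) : a, b ∈ D }; that is, ker μ is generated by { δ(d) : d ∈ D } under the deformed right action x ← b = (id_D ⊗ μ)(T₁₃(T₂₃(x ⊗ b))) of D^T, so (ker μ, δ) is a first order differential calculus over D^T. -/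
open TensorProduct

noncomputable section

theorem aux_flip (k : Type*) [Field k] (D : Type*) [Ring D] [Algebra k D] (y : D ⊗[k] D) :
    mul23 k D (LinearMap.mul' k D) (flip23 k D (y ⊗ₜ[k] (1 : D))) = y := by
  induction y with
  | zero => simp
  | tmul a b => simp [mul23, flip23]
  | add x y hx hy => rw [TensorProduct.add_tmul, map_add, map_add, hx, hy]

theorem aux_one (k : Type*) [Field k] (D : Type*) [Ring D] [Algebra k D]
    (T : D ⊗[k] D →ₗ[k] D ⊗[k] D) (hT : ∀ d : D, T ((1 : D) ⊗ₜ[k] d) = (1 : D) ⊗ₜ[k] d)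
    (y : D ⊗[k] D) :
    mul23 k D (LinearMap.mul' k D)
      (tensor13 k D T ((TensorProduct.assoc k D D D).symm ((1 : D) ⊗ₜ[k] y)))
      = (1 : D) ⊗ₜ[k] LinearMap.mul' k D y := by
  induction y with
  | zero => simp
  | tmul a b => simp [mul23, tensor13, tensor12, flip23, hT]
  | add x y hx hy =>
    rw [TensorProduct.tmul_add, map_add, map_add, map_add, hx, hy, map_add,
      TensorProduct.tmul_add]

theorem aux_ract (k : Type*) [Field k] (D : Type*) [Ring D] [Algebra k D]
    (T : D ⊗[k] D →ₗ[k] D ⊗[k] D) (hT : ∀ d : D, T ((1 : D) ⊗ₜ[k] d) = (1 : D) ⊗ₜ[k] d)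
    (a b : D) :
    ract k D T (delta k D a) b =
      T (a ⊗ₜ[k] b) - (1 : D) ⊗ₜ[k] LinearMap.mul' k D (T (a ⊗ₜ[k] b)) := by
  have h1 : tensor23 k D T ((a ⊗ₜ[k] (1 : D)) ⊗ₜ[k] b) = (a ⊗ₜ[k] (1 : D)) ⊗ₜ[k] b := by
    simp [tensor23, hT]
  have h2 : tensor23 k D T (((1 : D) ⊗ₜ[k] a) ⊗ₜ[k] b) =
      (TensorProduct.assoc k D D D).symm ((1 : D) ⊗ₜ[k] T (a ⊗ₜ[k] b)) := by
    simp [tensor23]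
  have h3 : tensor13 k D T ((a ⊗ₜ[k] (1 : D)) ⊗ₜ[k] b) =
      flip23 k D (T (a ⊗ₜ[k] b) ⊗ₜ[k] (1 : D)) := by
    have : flip23 k D ((a ⊗ₜ[k] (1 : D)) ⊗ₜ[k] b) = (a ⊗ₜ[k] b) ⊗ₜ[k] (1 : D) := by
      simp [flip23]
    simp [tensor13, tensor12, this]
  rw [ract, delta, TensorProduct.sub_tmul, map_sub, map_sub, map_sub, h1, h2, h3,
    aux_flip, aux_one k D T hT]

/-- Proposition 5.9: if the twistor `T` is bijective, then `ker μ` is generated by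
`{δ(d) : d ∈ D}` as a right `D^T`-module under the deformed right action, so
`(ker μ, δ)` is a first order differential calculus over `D^T`. -/
theorem kernel_mu_generated_by_delta (k : Type*) [Field k] (D : Type*) [Ring D] [Algebra k D]
    (T : D ⊗[k] D →ₗ[k] D ⊗[k] D) (hbij : Function.Bijective T)
    (hT : IsTwistor k D (LinearMap.mul' k D) 1 T) :
    (LinearMap.ker (LinearMap.mul' k D) : Submodule k (D ⊗[k] D)) =
      Submodule.span k { x : D ⊗[k] D | ∃ a b : D, x = ract k D T (delta k D a) b } := by
  have key := aux_ract k D T hT.one_left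
  apply le_antisymm
  · intro x hx
    obtain ⟨z, rfl⟩ := hbij.2 x
    have gen : ∀ z : D ⊗[k] D, T z - (1 : D) ⊗ₜ[k] LinearMap.mul' k D (T z) ∈
        Submodule.span k { x : D ⊗[k] D | ∃ a b : D, x = ract k D T (delta k D a) b } := by
      intro z
      induction z with
      | zero => simp
      | tmul a b => exact Submodule.subset_span ⟨a, b, (key a b).symm⟩
      | add x y hx hy =>
        have := Submodule.add_mem _ hx hy
        rw [map_add, map_add, TensorProduct.tmul_add, add_sub_add_comm]
        exact this
    have h := gen z
    rw [LinearMap.mem_ker.1 hx, TensorProduct.tmul_zero, sub_zero] at h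
    exact h
  · rw [Submodule.span_le]
    rintro _ ⟨a, b, rfl⟩
    rw [key]
    simp
end
end
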